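/- arXiv:2212.13833 — 3 statements merged into one kernel-verified Lean document; each statement's English description precedes it below -/
import Mathlib

section
/- Let R > 0 and Z > 0 and let Ω_R = (0,R)×(0,Z). Suppose v : [0,R]×[0,Z] → ℂ is continuous, is continuously differentiable in r on (0,R]×[0,Z], satisfies v(0,z) = 0 for every z ∈ [0,Z], and the integrals below are finite. Then ∫_{Ω_R} r^{-1}|v(r,z)|² dr dz ≤ R^{1/2} · (∫_{Ω_R} |v(r,z)|² dr dz)^{1/2} · (∫_{Ω_R} r^{-1}|∂_r v(r,z)|² dr dz)^{1/2}. -/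
open MeasureTheory Set

/-- A nonnegative quadratic `a s² - 2 c s + b` forces `c² ≤ a b`. -/
theorem sq_le_mul_of_forall_two_mul_le {a b c : ℝ}
    (h : ∀ s : ℝ, 2 * s * c ≤ s ^ 2 * a + b) : c ^ 2 ≤ a * b := by
  have hd : discrim a (-(2 * c)) b ≤ 0 :=
    discrim_le_zero fun s => by linarith [h s, mul_comm s c]
  unfold discrim at hd
  linarith

/-- If `f` vanishes at `0`, then `|f(r)|² ≤ r² ∫₀ᴿ |f'(t)|² t⁻¹ dt`. -/
theorem norm_sq_le_sq_mul_integral_deriv {E : Type*} [NormedAddCommGroup E] [NormedSpace ℝ E]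
    [CompleteSpace E] {R r : ℝ} (hr : r ∈ Ioo 0 R) {f f' : ℝ → E}
    (hf : ContinuousOn f (Icc 0 R)) (hf' : ∀ t ∈ Ioo 0 R, HasDerivAt f (f' t) t)
    (hcont : ContinuousOn f' (Ioo 0 R)) (h0 : f 0 = 0)
    (hint : IntegrableOn (fun t => ‖f' t‖ ^ 2 / t) (Ioo 0 R)) :
    ‖f r‖ ^ 2 ≤ r ^ 2 * ∫ t in Ioo 0 R, ‖f' t‖ ^ 2 / t := by
  obtain ⟨hr0, hrR⟩ := hr
  have hsub : Ioo 0 r ⊆ Ioo 0 R := Ioo_subset_Ioo_right hrR.le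
  have hint' := hint.mono_set hsub
  have hyoung : ∀ s t a : ℝ, 0 < t → 2 * s * a ≤ s ^ 2 * t + a ^ 2 / t := by
    intro s t a ht
    have h := mul_nonneg ht.le (sq_nonneg (s - a / t))
    have e : t * (s - a / t) ^ 2 = s ^ 2 * t + a ^ 2 / t - 2 * s * a := by
      field_simp
      ring
    linarith
  have hid : IntegrableOn (fun t : ℝ => t) (Ioo 0 r) :=
    (continuous_id.integrableOn_Icc (a := 0) (b := r)).mono_set Ioo_subset_Icc_self
  have hf'int : IntegrableOn f' (Ioo 0 r) := by
    refine (hid.add hint').mono'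
      ((hcont.mono hsub).aestronglyMeasurable measurableSet_Ioo) ?_
    filter_upwards [ae_restrict_mem measurableSet_Ioo] with t ht
    have h := hyoung 1 t ‖f' t‖ ht.1
    have hn := norm_nonneg (f' t)
    simp only [Pi.add_apply]
    linarith
  have hftc : ∫ t in Ioo 0 r, f' t = f r := by
    rw [← integral_Ioc_eq_integral_Ioo, ← intervalIntegral.integral_of_le hr0.le,
      intervalIntegral.integral_eq_sub_of_hasDerivAt_of_le hr0.le
        (hf.mono (Icc_subset_Icc_right hrR.le)) (fun t ht => hf' t (hsub ht))
        ((intervalIntegrable_iff_integrableOn_Ioo_of_le hr0.le).2 hf'int), h0, sub_zero]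
  have hle : ‖f r‖ ≤ ∫ t in Ioo 0 r, ‖f' t‖ := hftc ▸ norm_integral_le_integral_norm f'
  have hsq : (∫ t in Ioo 0 r, ‖f' t‖) ^ 2 ≤ r ^ 2 * ∫ t in Ioo 0 r, ‖f' t‖ ^ 2 / t := by
    refine sq_le_mul_of_forall_two_mul_le fun s => ?_
    have hmono : ∫ t in Ioo 0 r, 2 * s * ‖f' t‖ ≤
        ∫ t in Ioo 0 r, (s ^ 2 * t + ‖f' t‖ ^ 2 / t) :=
      setIntegral_mono_on (hf'int.norm.const_mul _) ((hid.const_mul _).add hint')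
        measurableSet_Ioo fun t ht => hyoung s t _ ht.1
    have hidval : ∫ t in Ioo 0 r, t = r ^ 2 / 2 := by
      rw [← integral_Ioc_eq_integral_Ioo, ← intervalIntegral.integral_of_le hr0.le, integral_id]
      ring
    rw [integral_const_mul, integral_add (hid.const_mul _) hint', integral_const_mul,
      hidval] at hmono
    nlinarith [sq_nonneg (s * r)]
  calc ‖f r‖ ^ 2 ≤ (∫ t in Ioo 0 r, ‖f' t‖) ^ 2 := by gcongr
    _ ≤ r ^ 2 * ∫ t in Ioo 0 r, ‖f' t‖ ^ 2 / t := hsq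
    _ ≤ r ^ 2 * ∫ t in Ioo 0 R, ‖f' t‖ ^ 2 / t := by
      refine mul_le_mul_of_nonneg_left (setIntegral_mono_set hint ?_ hsub.eventuallyLE)
        (sq_nonneg r)
      filter_upwards [ae_restrict_mem measurableSet_Ioo] with t ht
      exact div_nonneg (sq_nonneg _) ht.1.le

/-- A weighted Hardy-type inequality on the rectangle
`Ω_R = (0,R) × (0,Z)`: if `v` is continuous on `[0,R] × [0,Z]`, continuously
differentiable in `r` (with derivative `vr`) on `(0,R] × [0,Z]`, vanishes at
`r = 0`, and the three integrals below are finite, then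
`∫ r⁻¹|v|² ≤ √R · (∫|v|²)^{1/2} · (∫ r⁻¹|∂_r v|²)^{1/2}`. -/
theorem stmt0 (R Z : ℝ) (hR : 0 < R) (hZ : 0 < Z)
    (v vr : ℝ → ℝ → ℂ)
    (hv_cont : ContinuousOn (fun p : ℝ × ℝ => v p.1 p.2) (Icc 0 R ×ˢ Icc 0 Z))
    (hv_deriv : ∀ r ∈ Ioc (0 : ℝ) R, ∀ z ∈ Icc (0 : ℝ) Z,
      HasDerivAt (fun t : ℝ => v t z) (vr r z) r)
    (hvr_cont : ContinuousOn (fun p : ℝ × ℝ => vr p.1 p.2) (Ioc 0 R ×ˢ Icc 0 Z))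
    (hv0 : ∀ z ∈ Icc (0 : ℝ) Z, v 0 z = 0)
    (h1 : IntegrableOn (fun p : ℝ × ℝ => ‖v p.1 p.2‖ ^ 2 / p.1) (Ioo 0 R ×ˢ Ioo 0 Z))
    (h2 : IntegrableOn (fun p : ℝ × ℝ => ‖v p.1 p.2‖ ^ 2) (Ioo 0 R ×ˢ Ioo 0 Z))
    (h3 : IntegrableOn (fun p : ℝ × ℝ => ‖vr p.1 p.2‖ ^ 2 / p.1) (Ioo 0 R ×ˢ Ioo 0 Z)) :
    (∫ p in Ioo 0 R ×ˢ Ioo 0 Z, ‖v p.1 p.2‖ ^ 2 / p.1) ≤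
      Real.sqrt R * Real.sqrt (∫ p in Ioo 0 R ×ˢ Ioo 0 Z, ‖v p.1 p.2‖ ^ 2) *
        Real.sqrt (∫ p in Ioo 0 R ×ˢ Ioo 0 Z, ‖vr p.1 p.2‖ ^ 2 / p.1) := by
  have hprod : (volume : Measure (ℝ × ℝ)).restrict (Ioo 0 R ×ˢ Ioo 0 Z) =
      (volume.restrict (Ioo 0 R)).prod (volume.restrict (Ioo 0 Z)) := by
    rw [Measure.prod_restrict, Measure.volume_eq_prod]
  have h3' : Integrable (fun p : ℝ × ℝ => ‖vr p.1 p.2‖ ^ 2 / p.1)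
      ((volume.restrict (Ioo 0 R)).prod (volume.restrict (Ioo 0 Z))) := hprod ▸ h3
  set H : ℝ → ℝ := fun z => ∫ r in Ioo 0 R, ‖vr r z‖ ^ 2 / r with hH
  have hHint : IntegrableOn (fun p : ℝ × ℝ => H p.2) (Ioo 0 R ×ˢ Ioo 0 Z) := by
    rw [IntegrableOn, hprod]
    exact h3'.integral_prod_right.comp_snd _
  have hHval : ∫ p in Ioo 0 R ×ˢ Ioo 0 Z, H p.2 =
      R * ∫ p in Ioo 0 R ×ˢ Ioo 0 Z, ‖vr p.1 p.2‖ ^ 2 / p.1 := by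
    rw [hprod, integral_fun_snd, integral_prod_symm _ h3']
    simp [hH, hR.le]
  have hbound : ∀ᵐ p ∂(volume : Measure (ℝ × ℝ)).restrict (Ioo 0 R ×ˢ Ioo 0 Z),
      ‖v p.1 p.2‖ ^ 2 ≤ p.1 ^ 2 * H p.2 := by
    have hae : ∀ᵐ p ∂(volume : Measure (ℝ × ℝ)).restrict (Ioo 0 R ×ˢ Ioo 0 Z),
        IntegrableOn (fun r => ‖vr r p.2‖ ^ 2 / r) (Ioo 0 R) := by
      rw [hprod]
      exact Measure.quasiMeasurePreserving_snd.ae h3'.prod_left_ae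
    filter_upwards [hae, ae_restrict_mem (measurableSet_Ioo.prod measurableSet_Ioo)]
      with ⟨r, z⟩ hi hp
    have hz : z ∈ Icc 0 Z := Ioo_subset_Icc_self hp.2
    exact norm_sq_le_sq_mul_integral_deriv (f := fun t => v t z) (f' := fun t => vr t z) hp.1
      (hv_cont.comp (f := fun t => (t, z)) (by fun_prop) fun t ht => ⟨ht, hz⟩)
      (fun t ht => hv_deriv t (Ioo_subset_Ioc_self ht) z hz)
      (hvr_cont.comp (f := fun t => (t, z)) (by fun_prop)
        fun t ht => ⟨Ioo_subset_Ioc_self ht, hz⟩)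
      (hv0 z hz) hi
  have hsq : (∫ p in Ioo 0 R ×ˢ Ioo 0 Z, ‖v p.1 p.2‖ ^ 2 / p.1) ^ 2 ≤
      (∫ p in Ioo 0 R ×ˢ Ioo 0 Z, ‖v p.1 p.2‖ ^ 2) *
        (R * ∫ p in Ioo 0 R ×ˢ Ioo 0 Z, ‖vr p.1 p.2‖ ^ 2 / p.1) := by
    refine sq_le_mul_of_forall_two_mul_le fun s => ?_
    rw [← hHval, ← integral_const_mul, ← integral_const_mul,
      ← integral_add (h2.const_mul _) hHint]
    refine integral_mono_ae (h1.const_mul _) ((h2.const_mul _).add hHint) ?_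
    filter_upwards [hbound, ae_restrict_mem (measurableSet_Ioo.prod measurableSet_Ioo)]
      with ⟨r, z⟩ hb hp
    have hr : 0 < r := hp.1.1
    have hq : (‖v r z‖ / r) ^ 2 ≤ H z := by
      rw [div_pow, div_le_iff₀ (by positivity), mul_comm]
      exact hb
    have e : 2 * s * (‖v r z‖ ^ 2 / r) = 2 * (s * ‖v r z‖) * (‖v r z‖ / r) := by ring
    change 2 * s * (‖v r z‖ ^ 2 / r) ≤ s ^ 2 * ‖v r z‖ ^ 2 + H z
    rw [e]
    nlinarith [two_mul_le_add_sq (s * ‖v r z‖) (‖v r z‖ / r)]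
  have hG : 0 ≤ ∫ p in Ioo 0 R ×ˢ Ioo 0 Z, ‖v p.1 p.2‖ ^ 2 :=
    integral_nonneg fun p => sq_nonneg _
  rw [← Real.sqrt_mul hR.le, ← Real.sqrt_mul (by positivity)]
  refine Real.le_sqrt_of_sq_le (hsq.trans_eq ?_)
  ring
end

section
/- Let R > 0 and Z > 0 and let Ω_R = (0,R)×(0,Z). Let (v_n) be a sequence of functions on [0,R]×[0,Z] with values in ℂ, each continuous, continuously differentiable in r on (0,R]×[0,Z], and satisfying v_n(0,z) = 0 for all z ∈ [0,Z]. Assume there is M > 0 with ∫_{Ω_R} r^{-1}(|∂_r v_n|² + |∂_z v_n|²) dr dz ≤ M for all n, and assume (v_n) is a Cauchy sequence in L²(Ω_R), i.e. ∫_{Ω_R}|v_n − v_m|² dr dz → 0 as n,m → ∞. Then ∫_{Ω_R} r^{-1}|v_n − v_m|² dr dz → 0 as n,m → ∞, i.e. (v_n) is Cauchy in the weighted norm (∫_{Ω_R} r^{-1}|·|² dr dz)^{1/2}. -/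
open MeasureTheory Set Filter Topology

/-- Weighted Cauchy–Schwarz bound for a primitive away from the singular endpoint. -/
lemma enorm_sub_sq_le_lintegral_deriv_sq_div {f f' : ℝ → ℂ} {R a r : ℝ} (ha : 0 < a)
    (har : a ≤ r) (hrR : r < R) (hderiv : ∀ s ∈ Ioc (0 : ℝ) R, HasDerivAt f (f' s) s)
    (hcont : ContinuousOn f' (Ioc 0 R)) :
    ‖f r - f a‖ₑ ^ 2 ≤
      ENNReal.ofReal (r ^ 2) * ∫⁻ s in Ioo 0 R, ENNReal.ofReal (‖f' s‖ ^ 2 / s) := by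
  have hsub : Icc a r ⊆ Ioc 0 R := fun s hs => ⟨ha.trans_le hs.1, hs.2.trans hrR.le⟩
  have hsubo : Ioc a r ⊆ Ioo 0 R := fun s hs => ⟨ha.trans hs.1, hs.2.trans_lt hrR⟩
  have hcIcc : ContinuousOn f' (Icc a r) := hcont.mono hsub
  have hcIoc : ContinuousOn f' (Ioc a r) := hcIcc.mono Ioc_subset_Icc_self
  have hftc : ∫ s in a..r, f' s = f r - f a := by
    apply intervalIntegral.integral_eq_sub_of_hasDerivAt
    · intro s hs
      rw [uIcc_of_le har] at hs
      exact hderiv s (hsub hs)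
    · exact ContinuousOn.intervalIntegrable (by rwa [uIcc_of_le har])
  have hroot : ContinuousOn (fun s : ℝ => √s) (Ioc a r) := Real.continuous_sqrt.continuousOn
  have hroot_ne : ∀ s ∈ Ioc a r, √s ≠ 0 := fun s hs => (Real.sqrt_pos.2 (ha.trans hs.1)).ne'
  have hholder := ENNReal.lintegral_mul_le_Lp_mul_Lq (volume.restrict (Ioc a r))
    Real.HolderConjugate.two_two
    (f := fun s => ENNReal.ofReal √s) (g := fun s => ENNReal.ofReal (‖f' s‖ / √s))
    (hroot.aemeasurable measurableSet_Ioc).ennreal_ofReal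
    ((hcIoc.norm.div hroot hroot_ne).aemeasurable measurableSet_Ioc).ennreal_ofReal
  have hprod : ∫⁻ s in Ioc a r, ‖f' s‖ₑ = ∫⁻ s in Ioc a r,
      ((fun s => ENNReal.ofReal √s) * fun s => ENNReal.ofReal (‖f' s‖ / √s)) s := by
    refine setLIntegral_congr_fun measurableSet_Ioc fun s hs => ?_
    simp only [Pi.mul_apply]
    rw [← ENNReal.ofReal_mul (Real.sqrt_nonneg s), mul_div_cancel₀ _ (hroot_ne s hs),
      ofReal_norm]
  have hweight : ∫⁻ s in Ioc a r, ENNReal.ofReal √s ^ (2 : ℝ) ≤ ENNReal.ofReal (r ^ 2) := by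
    calc ∫⁻ s in Ioc a r, ENNReal.ofReal √s ^ (2 : ℝ)
        ≤ ∫⁻ _ in Ioc a r, ENNReal.ofReal r := by
          refine setLIntegral_mono measurable_const fun s hs => ?_
          rw [ENNReal.rpow_two, ← ENNReal.ofReal_pow (Real.sqrt_nonneg s),
            Real.sq_sqrt (ha.trans hs.1).le]
          exact ENNReal.ofReal_le_ofReal hs.2
      _ = ENNReal.ofReal (r * (r - a)) := by
          rw [setLIntegral_const, Real.volume_Ioc, ENNReal.ofReal_mul (ha.le.trans har)]
      _ ≤ ENNReal.ofReal (r ^ 2) := ENNReal.ofReal_le_ofReal (by nlinarith)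
  have henergy : ∫⁻ s in Ioc a r, ENNReal.ofReal (‖f' s‖ / √s) ^ (2 : ℝ) ≤
      ∫⁻ s in Ioo 0 R, ENNReal.ofReal (‖f' s‖ ^ 2 / s) := by
    refine le_trans (le_of_eq ?_) (lintegral_mono_set hsubo)
    refine setLIntegral_congr_fun measurableSet_Ioc fun s hs => ?_
    rw [ENNReal.rpow_two, ← ENNReal.ofReal_pow (by positivity), div_pow,
      Real.sq_sqrt (ha.trans hs.1).le]
  have hroot_sq : ∀ x : ENNReal, (x ^ (1 / 2 : ℝ)) ^ 2 = x := fun x => by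
    rw [← ENNReal.rpow_two, ← ENNReal.rpow_mul]; norm_num
  calc ‖f r - f a‖ₑ ^ 2 ≤ (∫⁻ s in Ioc a r, ‖f' s‖ₑ) ^ 2 := by
        gcongr
        rw [← hftc, intervalIntegral.integral_of_le har]
        exact enorm_integral_le_lintegral_enorm _
    _ ≤ _ := by
        rw [hprod]
        refine (pow_le_pow_left' hholder 2).trans ?_
        rw [mul_pow, hroot_sq, hroot_sq]
        exact mul_le_mul' hweight henergy

/-- A function vanishing at the origin is bounded by `r` times its weighted energy norm. -/
lemma enorm_sq_le_lintegral_deriv_sq_div {f f' : ℝ → ℂ} {R r : ℝ} (hr : r ∈ Ioo 0 R)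
    (hf : ContinuousOn f (Icc 0 R)) (hf0 : f 0 = 0)
    (hderiv : ∀ s ∈ Ioc (0 : ℝ) R, HasDerivAt f (f' s) s)
    (hcont : ContinuousOn f' (Ioc 0 R)) :
    ‖f r‖ₑ ^ 2 ≤
      ENNReal.ofReal (r ^ 2) * ∫⁻ s in Ioo 0 R, ENNReal.ofReal (‖f' s‖ ^ 2 / s) := by
  have hlim0 : Tendsto f (𝓝[>] 0) (𝓝 0) := by
    have h := (hf 0 (left_mem_Icc.2 (hr.1.trans hr.2).le)).mono_left
      (nhdsWithin_mono 0 (Ioc_subset_Icc_self (a := (0 : ℝ)) (b := R)))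
    rwa [nhdsWithin_Ioc_eq_nhdsGT (hr.1.trans hr.2), hf0] at h
  have hlim : Tendsto (fun a => ‖f r - f a‖ₑ ^ 2) (𝓝[>] 0) (𝓝 (‖f r‖ₑ ^ 2)) := by
    have h := (tendsto_const_nhds (x := f r)).sub hlim0
    rw [sub_zero] at h
    exact ((ENNReal.continuous_pow 2).tendsto _).comp h.enorm
  refine le_of_tendsto hlim ?_
  filter_upwards [Ioc_mem_nhdsGT hr.1] with a ha
  exact enorm_sub_sq_le_lintegral_deriv_sq_div ha.1 ha.2 hr.2 hderiv hcont

/-- Splitting at `r = δ`: small radii are controlled by `A` and `B`, large ones by `‖x - y‖`. -/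
lemma ofReal_norm_sub_sq_div_le {x y : ℂ} {r δ : ℝ} {A B : ENNReal} (hr : 0 < r) (hδ : 0 < δ)
    (hx : ‖x‖ₑ ^ 2 ≤ ENNReal.ofReal (r ^ 2) * A) (hy : ‖y‖ₑ ^ 2 ≤ ENNReal.ofReal (r ^ 2) * B) :
    ENNReal.ofReal (‖x - y‖ ^ 2 / r) ≤
      ENNReal.ofReal (2 * δ) * (A + B) +
        ENNReal.ofReal δ⁻¹ * ENNReal.ofReal (‖x - y‖ ^ 2) := by
  rcases le_total r δ with h | h
  · refine le_trans ?_ le_self_add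
    have hxy : ‖x - y‖ ^ 2 ≤ 2 * (‖x‖ ^ 2 + ‖y‖ ^ 2) := by
      nlinarith [norm_sub_le x y, norm_nonneg (x - y), sq_nonneg (‖x‖ - ‖y‖)]
    calc ENNReal.ofReal (‖x - y‖ ^ 2 / r)
        ≤ ENNReal.ofReal (2 * r⁻¹ * (‖x‖ ^ 2 + ‖y‖ ^ 2)) := by
          refine ENNReal.ofReal_le_ofReal ?_
          rw [div_eq_mul_inv]
          nlinarith [inv_pos.2 hr]
      _ = ENNReal.ofReal (2 * r⁻¹) * (‖x‖ₑ ^ 2 + ‖y‖ₑ ^ 2) := by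
          rw [ENNReal.ofReal_mul (by positivity), ENNReal.ofReal_add (by positivity)
            (by positivity), ENNReal.ofReal_pow (norm_nonneg _),
            ENNReal.ofReal_pow (norm_nonneg _), ofReal_norm, ofReal_norm]
      _ ≤ ENNReal.ofReal (2 * r⁻¹) * (ENNReal.ofReal (r ^ 2) * (A + B)) := by
          rw [mul_add (ENNReal.ofReal (r ^ 2))]
          gcongr
      _ = ENNReal.ofReal (2 * r) * (A + B) := by
          rw [← mul_assoc, ← ENNReal.ofReal_mul (by positivity)]
          congr 2
          field_simp
      _ ≤ _ := by gcongr
  · refine le_trans ?_ le_add_self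
    rw [← ENNReal.ofReal_mul (by positivity), div_eq_inv_mul]
    gcongr

/-- If a sequence `(v n)` of functions on `[0,R] × [0,Z]`,
each continuous, continuously differentiable in `r` on `(0,R] × [0,Z]`, and
vanishing at `r = 0`, has uniformly bounded weighted gradient integrals
`∫ r⁻¹(|∂_r v_n|² + |∂_z v_n|²) ≤ M` and is Cauchy in `L²(Ω_R)`, then it is
Cauchy with respect to the weighted norm `(∫ r⁻¹|·|²)^{1/2}`. -/
theorem stmt1 (R Z : ℝ) (hR : 0 < R) (hZ : 0 < Z)
    (v vr vz : ℕ → ℝ → ℝ → ℂ)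
    (hv_cont : ∀ n : ℕ, ContinuousOn (fun p : ℝ × ℝ => v n p.1 p.2) (Icc 0 R ×ˢ Icc 0 Z))
    (hv_derivr : ∀ n : ℕ, ∀ r ∈ Ioc (0 : ℝ) R, ∀ z ∈ Icc (0 : ℝ) Z,
      HasDerivAt (fun t : ℝ => v n t z) (vr n r z) r)
    (hv_derivz : ∀ n : ℕ, ∀ r ∈ Ioc (0 : ℝ) R, ∀ z ∈ Ioo (0 : ℝ) Z,
      HasDerivAt (fun t : ℝ => v n r t) (vz n r z) z)
    (hvr_cont : ∀ n : ℕ, ContinuousOn (fun p : ℝ × ℝ => vr n p.1 p.2) (Ioc 0 R ×ˢ Icc 0 Z))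
    (hv0 : ∀ n : ℕ, ∀ z ∈ Icc (0 : ℝ) Z, v n 0 z = 0)
    (M : ℝ) (hM : 0 < M)
    (hbound : ∀ n : ℕ, (∫⁻ p in Ioo 0 R ×ˢ Ioo 0 Z,
        ENNReal.ofReal ((‖vr n p.1 p.2‖ ^ 2 + ‖vz n p.1 p.2‖ ^ 2) / p.1)) ≤
        ENNReal.ofReal M)
    (hcauchy : ∀ ε : ℝ, 0 < ε → ∃ N : ℕ, ∀ n ≥ N, ∀ m ≥ N,
        (∫⁻ p in Ioo 0 R ×ˢ Ioo 0 Z,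
          ENNReal.ofReal (‖v n p.1 p.2 - v m p.1 p.2‖ ^ 2)) < ENNReal.ofReal ε) :
    ∀ ε : ℝ, 0 < ε → ∃ N : ℕ, ∀ n ≥ N, ∀ m ≥ N,
      (∫⁻ p in Ioo 0 R ×ˢ Ioo 0 Z,
        ENNReal.ofReal (‖v n p.1 p.2 - v m p.1 p.2‖ ^ 2 / p.1)) < ENNReal.ofReal ε := by
  set G : ℕ → ℝ → ENNReal := fun n z =>
    ∫⁻ s in Ioo 0 R, ENNReal.ofReal (‖vr n s z‖ ^ 2 / s)
  set μ : Measure ℝ := volume.restrict (Ioo 0 R) with hμ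
  set ν : Measure ℝ := volume.restrict (Ioo 0 Z) with hν
  have hΩ : (volume : Measure (ℝ × ℝ)).restrict (Ioo 0 R ×ˢ Ioo 0 Z) = μ.prod ν := by
    rw [hμ, hν, Measure.prod_restrict, Measure.volume_eq_prod]
  have hmeas : ∀ n, AEMeasurable
      (fun p : ℝ × ℝ => ENNReal.ofReal (‖vr n p.1 p.2‖ ^ 2 / p.1)) (μ.prod ν) := by
    intro n
    rw [← hΩ]
    have hsub : Ioo 0 R ×ˢ Ioo 0 Z ⊆ Ioc 0 R ×ˢ Icc 0 Z :=
      prod_mono Ioo_subset_Ioc_self Ioo_subset_Icc_self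
    exact (ContinuousOn.aemeasurable
      ((((hvr_cont n).mono hsub).norm.pow 2).div continuous_fst.continuousOn
        fun p hp => hp.1.1.ne')
      (measurableSet_Ioo.prod measurableSet_Ioo)).ennreal_ofReal
  have hG_meas : ∀ n, AEMeasurable (G n) ν := fun n => (hmeas n).lintegral_prod_left'
  have hG_le : ∀ n, ∫⁻ z, G n z ∂ν ≤ ENNReal.ofReal M := by
    intro n
    rw [← lintegral_prod_symm _ (hmeas n), ← hΩ]
    refine le_trans (setLIntegral_mono' (measurableSet_Ioo.prod measurableSet_Ioo)
      fun p hp => ENNReal.ofReal_le_ofReal ?_) (hbound n)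
    have := hp.1.1
    gcongr
    exact le_add_of_nonneg_right (sq_nonneg _)
  have hv_le : ∀ n, ∀ p ∈ Ioo 0 R ×ˢ Ioo 0 Z,
      ‖v n p.1 p.2‖ₑ ^ 2 ≤ ENNReal.ofReal (p.1 ^ 2) * G n p.2 := by
    rintro n ⟨r, z⟩ ⟨hr, hz⟩
    have hz' : z ∈ Icc 0 Z := Ioo_subset_Icc_self hz
    have hslice : Continuous fun t : ℝ => (t, z) := by fun_prop
    exact enorm_sq_le_lintegral_deriv_sq_div (f := fun t => v n t z) (f' := fun t => vr n t z) hr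
      ((hv_cont n).comp hslice.continuousOn fun t ht => ⟨ht, hz'⟩) (hv0 n z hz')
      (fun s hs => hv_derivr n s hs z hz')
      ((hvr_cont n).comp hslice.continuousOn fun t ht => ⟨ht, hz'⟩)
  intro ε hε
  obtain ⟨δ, hδ, hδε⟩ : ∃ δ : ℝ, 0 < δ ∧ 2 * δ * (R * (M + M)) = ε / 2 :=
    ⟨ε / (8 * R * M), by positivity, by field_simp; norm_num⟩
  obtain ⟨N, hN⟩ := hcauchy (δ * (ε / 2)) (by positivity)
  refine ⟨N, fun n hn m hm => ?_⟩
  have hsum_meas : AEMeasurable (fun p : ℝ × ℝ =>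
      ENNReal.ofReal (2 * δ) * (G n p.2 + G m p.2)) (μ.prod ν) :=
    (((hG_meas n).comp_snd).add (hG_meas m).comp_snd).const_mul _
  have hsum : ∫⁻ p, ENNReal.ofReal (2 * δ) * (G n p.2 + G m p.2) ∂(μ.prod ν) ≤
      ENNReal.ofReal (ε / 2) := by
    rw [lintegral_prod _ hsum_meas]
    dsimp only
    rw [lintegral_const, lintegral_const_mul' _ _ ENNReal.ofReal_ne_top, lintegral_add_left' (hG_meas n), hμ,
      Measure.restrict_apply_univ, Real.volume_Ioo, sub_zero, ← hδε, mul_assoc,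
      ENNReal.ofReal_mul (p := 2 * δ) (by positivity), ENNReal.ofReal_mul hR.le,
      ENNReal.ofReal_add hM.le hM.le, mul_comm (ENNReal.ofReal R)]
    gcongr
    exacts [hG_le n, hG_le m]
  calc ∫⁻ p in Ioo 0 R ×ˢ Ioo 0 Z, ENNReal.ofReal (‖v n p.1 p.2 - v m p.1 p.2‖ ^ 2 / p.1)
      ≤ ∫⁻ p in Ioo 0 R ×ˢ Ioo 0 Z, (ENNReal.ofReal (2 * δ) * (G n p.2 + G m p.2) +
          ENNReal.ofReal δ⁻¹ * ENNReal.ofReal (‖v n p.1 p.2 - v m p.1 p.2‖ ^ 2)) :=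
        setLIntegral_mono' (measurableSet_Ioo.prod measurableSet_Ioo) fun p hp =>
          ofReal_norm_sub_sq_div_le hp.1.1 hδ (hv_le n p hp) (hv_le m p hp)
    _ = ∫⁻ p, ENNReal.ofReal (2 * δ) * (G n p.2 + G m p.2) ∂(μ.prod ν) +
          ENNReal.ofReal δ⁻¹ * ∫⁻ p in Ioo 0 R ×ˢ Ioo 0 Z,
            ENNReal.ofReal (‖v n p.1 p.2 - v m p.1 p.2‖ ^ 2) := by
        rw [hΩ, lintegral_add_left' hsum_meas,
          lintegral_const_mul' (ENNReal.ofReal δ⁻¹) _ ENNReal.ofReal_ne_top]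
    _ < ENNReal.ofReal (ε / 2) + ENNReal.ofReal δ⁻¹ * ENNReal.ofReal (δ * (ε / 2)) :=
        ENNReal.add_lt_add_of_le_of_lt (hsum.trans_lt ENNReal.ofReal_lt_top).ne hsum
          (ENNReal.mul_lt_mul_right (ENNReal.ofReal_pos.2 (inv_pos.2 hδ)).ne'
            ENNReal.ofReal_ne_top (hN n hn m hm))
    _ = ENNReal.ofReal ε := by
        rw [← ENNReal.ofReal_mul (by positivity), inv_mul_cancel_left₀ hδ.ne',
          ← ENNReal.ofReal_add (by positivity) (by positivity), add_halves]
end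

section
/- Fix R > 0, χ₀ > 0, ρ ≥ 2R, and set d = ρ − R. On [R,ρ] define χ(r) = χ₀(r−R)², α(r) = 1 + 2(1+i)χ₀(r−R), β(r) = 1 + (1+i)χ(r)/r, and the real weights ξ(r) = (r + rχ'(r) + χ(r))/|rα(r)β(r)|², η(r) = (r + rχ'(r) + χ(r) + 2χ(r)χ'(r))/|rβ(r)|², ξ₁(r) = (rχ'(r) + χ(r) + 2χ(r)χ'(r))/|rα(r)β(r)|², η₁(r) = (rχ'(r) − χ(r))/|rβ(r)|². For a real number λ and a continuously differentiable v : [R,ρ] → ℂ, define 𝒜_λ(v,v) = ∫_R^ρ (r β(r))^{-1} ( α(r)^{-1} |v'(r)|² − λ α(r) |v(r)|² ) dr. Then Re 𝒜_λ(v,v) = ∫_R^ρ ( ξ(r)|v'(r)|² − λ η(r)|v(r)|² ) dr and Im 𝒜_λ(v,v) = − ∫_R^ρ ( ξ₁(r)|v'(r)|² + λ η₁(r)|v(r)|² ) dr. -/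
noncomputable section

/-- The quadratic PML absorbing profile `χ(r) = χ₀(r−R)²`. -/
def pmlChi (χ₀ R r : ℝ) : ℝ := χ₀ * (r - R) ^ 2

/-- Its derivative `χ'(r) = 2χ₀(r−R)`. -/
def pmlChi' (χ₀ R r : ℝ) : ℝ := 2 * χ₀ * (r - R)

/-- `α(r) = 1 + 2(1+i)χ₀(r−R)`, the derivative of the complex stretching. -/
def pmlAlpha (χ₀ R r : ℝ) : ℂ := 1 + 2 * (1 + Complex.I) * ((χ₀ * (r - R) : ℝ) : ℂ)

/-- `β(r) = 1 + (1+i)χ(r)/r`. -/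
def pmlBeta (χ₀ R r : ℝ) : ℂ := 1 + (1 + Complex.I) * ((pmlChi χ₀ R r : ℝ) : ℂ) / (r : ℂ)

/-- The real weight `ξ(r) = (r + rχ'(r) + χ(r))/|rα(r)β(r)|²`. -/
def pmlXi (χ₀ R r : ℝ) : ℝ :=
  (r + r * pmlChi' χ₀ R r + pmlChi χ₀ R r) /
    ‖(r : ℂ) * pmlAlpha χ₀ R r * pmlBeta χ₀ R r‖ ^ 2

/-- The real weight `η(r) = (r + rχ'(r) + χ(r) + 2χ(r)χ'(r))/|rβ(r)|²`. -/
def pmlEta (χ₀ R r : ℝ) : ℝ :=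
  (r + r * pmlChi' χ₀ R r + pmlChi χ₀ R r + 2 * pmlChi χ₀ R r * pmlChi' χ₀ R r) /
    ‖(r : ℂ) * pmlBeta χ₀ R r‖ ^ 2

/-- The real weight `ξ₁(r) = (rχ'(r) + χ(r) + 2χ(r)χ'(r))/|rα(r)β(r)|²`. -/
def pmlXi1 (χ₀ R r : ℝ) : ℝ :=
  (r * pmlChi' χ₀ R r + pmlChi χ₀ R r + 2 * pmlChi χ₀ R r * pmlChi' χ₀ R r) /
    ‖(r : ℂ) * pmlAlpha χ₀ R r * pmlBeta χ₀ R r‖ ^ 2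

/-- The real weight `η₁(r) = (rχ'(r) − χ(r))/|rβ(r)|²`. -/
def pmlEta1 (χ₀ R r : ℝ) : ℝ :=
  (r * pmlChi' χ₀ R r - pmlChi χ₀ R r) / ‖(r : ℂ) * pmlBeta χ₀ R r‖ ^ 2

/-- The PML sesquilinear (quadratic) form
`𝒜_λ(v,v) = ∫_R^ρ (rβ)⁻¹ (α⁻¹|v'|² − λα|v|²) dr`. -/
def pmlForm (χ₀ R ρ lam : ℝ) (v v' : ℝ → ℂ) : ℂ :=
  ∫ r in R..ρ, ((r : ℂ) * pmlBeta χ₀ R r)⁻¹ *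
    ((pmlAlpha χ₀ R r)⁻¹ * ((‖v' r‖ ^ 2 : ℝ) : ℂ) -
      (lam : ℂ) * pmlAlpha χ₀ R r * ((‖v r‖ ^ 2 : ℝ) : ℂ))

end

/-- The stretched radius `r β(r)` is `r + χ(r) + i χ(r)`. -/
theorem ofReal_mul_pmlBeta {r : ℝ} (hr : r ≠ 0) (χ₀ R : ℝ) :
    (r : ℂ) * pmlBeta χ₀ R r = ⟨r + pmlChi χ₀ R r, pmlChi χ₀ R r⟩ := by
  have hr' : (r : ℂ) ≠ 0 := Complex.ofReal_ne_zero.mpr hr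
  have h : (r : ℂ) * pmlBeta χ₀ R r = r + (1 + Complex.I) * (pmlChi χ₀ R r : ℂ) := by
    rw [pmlBeta]
    field_simp
  rw [h]
  apply Complex.ext <;> simp

theorem pmlAlpha_eq (χ₀ R r : ℝ) :
    pmlAlpha χ₀ R r = ⟨1 + pmlChi' χ₀ R r, pmlChi' χ₀ R r⟩ := by
  apply Complex.ext <;> simp [pmlAlpha, pmlChi'] <;> ring

theorem ofReal_mul_pmlBeta_ne_zero {χ₀ R r : ℝ} (hχ₀ : 0 ≤ χ₀) (hr : 0 < r) :
    (r : ℂ) * pmlBeta χ₀ R r ≠ 0 := by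
  intro h
  have hre := congrArg Complex.re h
  rw [ofReal_mul_pmlBeta hr.ne'] at hre
  have : 0 < r + pmlChi χ₀ R r := by unfold pmlChi; positivity
  exact this.ne' hre

theorem pmlAlpha_ne_zero {χ₀ R r : ℝ} (hχ₀ : 0 ≤ χ₀) (hr : R ≤ r) : pmlAlpha χ₀ R r ≠ 0 := by
  intro h
  have hre := congrArg Complex.re h
  rw [pmlAlpha_eq] at hre
  have : 0 < 1 + pmlChi' χ₀ R r := by
    have := sub_nonneg.mpr hr
    unfold pmlChi'
    positivity
  exact this.ne' hre

theorem inv_mul_inv_pmlAlpha {r : ℝ} (hr : r ≠ 0) (χ₀ R : ℝ) :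
    ((r : ℂ) * pmlBeta χ₀ R r)⁻¹ * (pmlAlpha χ₀ R r)⁻¹ =
      ⟨pmlXi χ₀ R r, -pmlXi1 χ₀ R r⟩ := by
  have h : (r : ℂ) * pmlAlpha χ₀ R r * pmlBeta χ₀ R r =
      ((r : ℂ) * pmlBeta χ₀ R r) * pmlAlpha χ₀ R r := by ring
  rw [← mul_inv, pmlXi, pmlXi1, h, ofReal_mul_pmlBeta hr, pmlAlpha_eq, ← Complex.normSq_eq_norm_sq]
  apply Complex.ext
  · rw [Complex.inv_re]
    congr 1
    simp only [Complex.mul_re]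
    ring
  · rw [Complex.inv_im, ← neg_div]
    congr 1
    simp only [Complex.mul_im]
    ring

theorem inv_mul_pmlAlpha {r : ℝ} (hr : r ≠ 0) (χ₀ R : ℝ) :
    ((r : ℂ) * pmlBeta χ₀ R r)⁻¹ * pmlAlpha χ₀ R r = ⟨pmlEta χ₀ R r, pmlEta1 χ₀ R r⟩ := by
  rw [pmlEta, pmlEta1, ofReal_mul_pmlBeta hr, pmlAlpha_eq, ← Complex.normSq_eq_norm_sq]
  apply Complex.ext
  · simp only [Complex.mul_re, Complex.inv_re, Complex.inv_im]
    ring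
  · simp only [Complex.mul_im, Complex.inv_re, Complex.inv_im]
    ring

/-- The integrand of the PML form, split into real and imaginary parts. -/
theorem pmlForm_integrand_eq {r : ℝ} (hr : r ≠ 0) (χ₀ R lam a b : ℝ) :
    ((r : ℂ) * pmlBeta χ₀ R r)⁻¹ *
        ((pmlAlpha χ₀ R r)⁻¹ * (a : ℂ) - (lam : ℂ) * pmlAlpha χ₀ R r * (b : ℂ)) =
      ⟨pmlXi χ₀ R r * a - lam * pmlEta χ₀ R r * b,
        -(pmlXi1 χ₀ R r * a + lam * pmlEta1 χ₀ R r * b)⟩ := by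
  have h : ((r : ℂ) * pmlBeta χ₀ R r)⁻¹ *
        ((pmlAlpha χ₀ R r)⁻¹ * (a : ℂ) - (lam : ℂ) * pmlAlpha χ₀ R r * (b : ℂ)) =
      ((r : ℂ) * pmlBeta χ₀ R r)⁻¹ * (pmlAlpha χ₀ R r)⁻¹ * (a : ℂ) -
        (lam : ℂ) * (((r : ℂ) * pmlBeta χ₀ R r)⁻¹ * pmlAlpha χ₀ R r) * (b : ℂ) := by ring
  rw [h, inv_mul_inv_pmlAlpha hr, inv_mul_pmlAlpha hr]
  apply Complex.ext <;> simp
  ring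

theorem continuousOn_pmlForm_integrand {χ₀ R ρ lam : ℝ} (hR : 0 < R) (hχ₀ : 0 ≤ χ₀)
    {v v' : ℝ → ℂ} (hv : ContinuousOn v (Set.Icc R ρ)) (hv' : ContinuousOn v' (Set.Icc R ρ)) :
    ContinuousOn (fun r : ℝ => ((r : ℂ) * pmlBeta χ₀ R r)⁻¹ *
      ((pmlAlpha χ₀ R r)⁻¹ * ((‖v' r‖ ^ 2 : ℝ) : ℂ) -
        (lam : ℂ) * pmlAlpha χ₀ R r * ((‖v r‖ ^ 2 : ℝ) : ℂ))) (Set.Icc R ρ) := by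
  have hpos : ∀ r ∈ Set.Icc R ρ, 0 < r := fun r hr => hR.trans_le hr.1
  have hα : ContinuousOn (pmlAlpha χ₀ R) (Set.Icc R ρ) := by
    unfold pmlAlpha
    fun_prop
  have hβ : ContinuousOn (pmlBeta χ₀ R) (Set.Icc R ρ) := by
    unfold pmlBeta pmlChi
    refine continuousOn_const.add (ContinuousOn.div (by fun_prop) (by fun_prop) fun r hr => ?_)
    exact Complex.ofReal_ne_zero.mpr (hpos r hr).ne'
  have hw : ContinuousOn (fun r : ℝ => ((r : ℂ) * pmlBeta χ₀ R r)⁻¹) (Set.Icc R ρ) :=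
    (Complex.continuous_ofReal.continuousOn.mul hβ).inv₀ fun r hr =>
      ofReal_mul_pmlBeta_ne_zero hχ₀ (hpos r hr)
  have hαi : ContinuousOn (fun r => (pmlAlpha χ₀ R r)⁻¹) (Set.Icc R ρ) :=
    hα.inv₀ fun r hr => pmlAlpha_ne_zero hχ₀ hr.1
  fun_prop

/-- Explicit formulas for the real and imaginary parts of the
PML quadratic form `𝒜_λ(v,v)` in terms of the real weights `ξ, η, ξ₁, η₁`. -/
theorem stmt4 (R χ₀ ρ : ℝ) (hR : 0 < R) (hχ₀ : 0 < χ₀) (hρ : 2 * R ≤ ρ)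
    (lam : ℝ) (v v' : ℝ → ℂ)
    (hv : ∀ r ∈ Set.Icc R ρ, HasDerivAt v (v' r) r)
    (hv' : ContinuousOn v' (Set.Icc R ρ)) :
    (pmlForm χ₀ R ρ lam v v').re =
        (∫ r in R..ρ, (pmlXi χ₀ R r * ‖v' r‖ ^ 2 - lam * pmlEta χ₀ R r * ‖v r‖ ^ 2)) ∧
      (pmlForm χ₀ R ρ lam v v').im =
        -∫ r in R..ρ, (pmlXi1 χ₀ R r * ‖v' r‖ ^ 2 + lam * pmlEta1 χ₀ R r * ‖v r‖ ^ 2) := by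
  have hRρ : R ≤ ρ := by linarith
  have hint := (continuousOn_pmlForm_integrand (lam := lam) hR hχ₀.le
    (fun r hr => (hv r hr).continuousAt.continuousWithinAt) hv').intervalIntegrable_of_Icc
      (μ := MeasureTheory.volume) hRρ
  have hne : ∀ r ∈ Set.uIcc R ρ, r ≠ 0 := fun r hr => by
    rw [Set.uIcc_of_le hRρ] at hr
    exact (hR.trans_le hr.1).ne'
  constructor
  · refine (Complex.reCLM.intervalIntegral_comp_comm hint).symm.trans
      (intervalIntegral.integral_congr fun r hr => ?_)
    exact congrArg Complex.re (pmlForm_integrand_eq (hne r hr) χ₀ R lam _ _)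
  · rw [← intervalIntegral.integral_neg]
    refine (Complex.imCLM.intervalIntegral_comp_comm hint).symm.trans
      (intervalIntegral.integral_congr fun r hr => ?_)
    exact congrArg Complex.im (pmlForm_integrand_eq (hne r hr) χ₀ R lam _ _)
end
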